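/- For every y ∈ ℝ^n and τ > 0, the function x ↦ (1/2)‖x − y‖² + τ·‖x‖₁ on ℝ^n attains its minimum at the unique point whose i-th coordinate is sign(y_i)·max(|y_i| − τ, 0); i.e., this point is a minimizer, and any minimizer equals it. -/

import Mathlib

/-- Soft thresholding `t` by `τ` minimizes `x ↦ (1/2)(x - t)² + τ|x|`, with quadratic growth. -/
lemma soft_threshold_quadratic_growth {τ t s : ℝ} (hτ : 0 ≤ τ)
    (hs : s = Real.sign t * max (|t| - τ) 0) (x : ℝ) :
    (1 / 2) * (s - t) ^ 2 + τ * |s| + (1 / 2) * (x - s) ^ 2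
      ≤ (1 / 2) * (x - t) ^ 2 + τ * |x| := by
  have h₁ : τ * x ≤ τ * |x| := mul_le_mul_of_nonneg_left (le_abs_self x) hτ
  have h₂ : τ * -x ≤ τ * |x| := mul_le_mul_of_nonneg_left (neg_le_abs x) hτ
  rcases le_total |t| τ with h | h
  · have hs0 : s = 0 := by rw [hs, max_eq_right (by linarith), mul_zero]
    have htx : t * x ≤ τ * |x| :=
      (le_abs_self _).trans (by rw [abs_mul]; gcongr)
    rw [hs0, abs_zero]
    linarith
  · rw [max_eq_left (by linarith)] at hs
    rcases lt_trichotomy t 0 with ht | rfl | ht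
    · rw [Real.sign_of_neg ht, abs_of_neg ht] at hs
      rw [abs_of_neg ht] at h
      rw [abs_of_nonpos (by linarith : s ≤ 0), hs]
      nlinarith
    · have hτ0 : τ = 0 := le_antisymm (by simpa using h) hτ
      simp [hs, hτ0]
    · rw [Real.sign_of_pos ht, abs_of_pos ht] at hs
      rw [abs_of_pos ht] at h
      rw [abs_of_nonneg (by linarith : 0 ≤ s), hs]
      nlinarith


/-- For every `y ∈ ℝⁿ` and `τ > 0`, the function
`x ↦ (1/2)‖x − y‖² + τ·‖x‖₁` on `ℝⁿ` attains its minimum at the unique point `p` whose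
`i`-th coordinate is `sign(y i)·max(|y i| − τ, 0)`: `p` is a minimizer, and any
minimizer equals `p`. -/
theorem vector_soft_thresholding_unique_minimizer {n : ℕ}
    (y : EuclideanSpace ℝ (Fin n)) (τ : ℝ) (hτ : 0 < τ)
    (p : EuclideanSpace ℝ (Fin n))
    (hp : ∀ i, p i = Real.sign (y i) * max (|y i| - τ) 0) :
    (∀ x : EuclideanSpace ℝ (Fin n),
      (1 / 2) * ‖p - y‖ ^ 2 + τ * ∑ i, |p i|
        ≤ (1 / 2) * ‖x - y‖ ^ 2 + τ * ∑ i, |x i|) ∧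
    (∀ x : EuclideanSpace ℝ (Fin n),
      (∀ z : EuclideanSpace ℝ (Fin n),
        (1 / 2) * ‖x - y‖ ^ 2 + τ * ∑ i, |x i|
          ≤ (1 / 2) * ‖z - y‖ ^ 2 + τ * ∑ i, |z i|) →
        x = p) := by
  have growth (x : EuclideanSpace ℝ (Fin n)) :
      (1 / 2) * ‖p - y‖ ^ 2 + τ * ∑ i, |p i| + (1 / 2) * ‖x - p‖ ^ 2
        ≤ (1 / 2) * ‖x - y‖ ^ 2 + τ * ∑ i, |x i| := by
    simp only [EuclideanSpace.real_norm_sq_eq, PiLp.sub_apply, Finset.mul_sum,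
      ← Finset.sum_add_distrib]
    exact Finset.sum_le_sum fun i _ => soft_threshold_quadratic_growth hτ.le (hp i) (x i)
  refine ⟨fun x => ?_, fun x hx => ?_⟩
  · linarith [growth x, sq_nonneg ‖x - p‖]
  · have hsq : ‖x - p‖ ^ 2 = 0 :=
      le_antisymm (by linarith [growth x, hx p]) (sq_nonneg _)
    exact sub_eq_zero.mp (norm_eq_zero.mp (pow_eq_zero_iff two_ne_zero |>.mp hsq))
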